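/- arXiv:1512.05010 — 9 statements merged into one kernel-verified Lean document; each statement's English description precedes it below -/
import Mathlib

section
/- Let γ* be a minimizer of the MPPC energy E over all multiple curves. Then λ₁ · λ₂ · (comp(γ*) − 1) ≤ (diam(supp μ))^p · μ(ℝ^d). In particular, the number of components of any minimizer is at most 1 + (diam(supp μ))^p μ(ℝ^d)/(λ₁λ₂). -/
open MeasureTheory Metric Set

noncomputable section

/-- A multiple curve: a finite family of Lipschitz curves `[0,1] → ℝ^d`. -/
structure MultiCurve (d : ℕ) where
  k : ℕ
  hk : 1 ≤ k
  curves : Fin k → ℝ → EuclideanSpace ℝ (Fin d)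
  lipschitz : ∀ i, ∃ C : NNReal, LipschitzOnWith C (curves i) (Set.Icc 0 1)

/-- The image `Γ` of a multiple curve. -/
def MultiCurve.image {d : ℕ} (γ : MultiCurve d) : Set (EuclideanSpace ℝ (Fin d)) :=
  ⋃ i, γ.curves i '' Set.Icc 0 1

/-- The total length of a multiple curve: sum of total variations over `[0,1]`. -/
def MultiCurve.length {d : ℕ} (γ : MultiCurve d) : ℝ :=
  ∑ i, (eVariationOn (γ.curves i) (Set.Icc 0 1)).toReal

/-- The MPPC energy. -/
def mppcEnergy {d : ℕ} (μ : Measure (EuclideanSpace ℝ (Fin d))) (p lam₁ lam₂ : ℝ)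
    (γ : MultiCurve d) : ℝ :=
  (∫ x, Metric.infDist x γ.image ^ p ∂μ) + lam₁ * (γ.length + lam₂ * ((γ.k : ℝ) - 1))

/-- The support of a measure: points all of whose neighborhoods have positive measure. -/
def msupport {d : ℕ} (μ : Measure (EuclideanSpace ℝ (Fin d))) : Set (EuclideanSpace ℝ (Fin d)) :=
  {x | ∀ ε > 0, 0 < μ (Metric.ball x ε)}

end

theorem msupport_eq_support {d : ℕ} (μ : Measure (EuclideanSpace ℝ (Fin d))) :
    msupport μ = μ.support := by
  ext x
  exact (nhds_basis_ball.mem_measureSupport (μ := μ)).symm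

/-- The multiple curve consisting of one constant curve. -/
def MultiCurve.point {d : ℕ} (x₀ : EuclideanSpace ℝ (Fin d)) : MultiCurve d where
  k := 1
  hk := le_rfl
  curves _ _ := x₀
  lipschitz _ := ⟨0, (LipschitzWith.const x₀).lipschitzOnWith⟩

theorem MultiCurve.image_point {d : ℕ} (x₀ : EuclideanSpace ℝ (Fin d)) :
    (MultiCurve.point x₀).image = {x₀} := by
  have : Nonempty (Fin (MultiCurve.point x₀).k) := ⟨⟨0, (MultiCurve.point x₀).hk⟩⟩
  have h : (Icc (0 : ℝ) 1).Nonempty := nonempty_Icc.2 zero_le_one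
  simp only [MultiCurve.image, MultiCurve.point, h.image_const, iUnion_const]

theorem MultiCurve.length_point {d : ℕ} (x₀ : EuclideanSpace ℝ (Fin d)) :
    (MultiCurve.point x₀).length = 0 := by
  refine Finset.sum_eq_zero fun i _ => ?_
  rw [eVariationOn.constant_on (subsingleton_singleton.anti (image_subset_iff.2 fun _ _ => rfl) :
    ((MultiCurve.point x₀).curves i '' Icc 0 1).Subsingleton), ENNReal.toReal_zero]

theorem MultiCurve.length_nonneg {d : ℕ} (γ : MultiCurve d) : 0 ≤ γ.length :=
  Finset.sum_nonneg fun _ _ => ENNReal.toReal_nonneg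

theorem le_mppcEnergy {d : ℕ} (μ : Measure (EuclideanSpace ℝ (Fin d))) (p : ℝ) {lam₁ : ℝ}
    (lam₂ : ℝ) (hlam₁ : 0 ≤ lam₁) (γ : MultiCurve d) :
    lam₁ * lam₂ * ((γ.k : ℝ) - 1) ≤ mppcEnergy μ p lam₁ lam₂ γ := by
  have hint : 0 ≤ ∫ x, infDist x γ.image ^ p ∂μ :=
    integral_nonneg fun _ => Real.rpow_nonneg infDist_nonneg p
  have hlen := mul_nonneg hlam₁ γ.length_nonneg
  unfold mppcEnergy
  linarith

theorem mppcEnergy_point_le {d : ℕ} (μ : Measure (EuclideanSpace ℝ (Fin d))) [IsFiniteMeasure μ]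
    {p : ℝ} (lam₁ lam₂ : ℝ) (hp : 0 ≤ p) (hb : Bornology.IsBounded (msupport μ))
    {x₀ : EuclideanSpace ℝ (Fin d)} (hx₀ : x₀ ∈ msupport μ) :
    mppcEnergy μ p lam₁ lam₂ (MultiCurve.point x₀) ≤
      diam (msupport μ) ^ p * (μ univ).toReal := by
  have hae : ∀ᵐ x ∂μ, x ∈ msupport μ := msupport_eq_support μ ▸ μ.support_mem_ae
  have hint : ∫ x, dist x x₀ ^ p ∂μ ≤ diam (msupport μ) ^ p * (μ univ).toReal := by
    refine (Real.le_norm_self _).trans (norm_integral_le_of_norm_le_const ?_)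
    filter_upwards [hae] with x hx
    rw [Real.norm_of_nonneg (Real.rpow_nonneg dist_nonneg p)]
    exact Real.rpow_le_rpow dist_nonneg (dist_le_diam_of_mem hb hx hx₀) hp
  have hk : ((MultiCurve.point x₀).k : ℝ) = 1 := Nat.cast_one
  simpa [mppcEnergy, MultiCurve.image_point, MultiCurve.length_point, hk] using hint

/-- Any minimizer of the MPPC energy satisfies
`λ₁ λ₂ (comp γ* − 1) ≤ diam(supp μ)^p · μ(ℝ^d)`; in particular the number of
components is at most `1 + diam(supp μ)^p μ(ℝ^d)/(λ₁ λ₂)`. -/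
theorem mppc_minimizer_component_bound (d : ℕ) (hd : 2 ≤ d) (p lam₁ lam₂ : ℝ)
    (hp : 1 ≤ p) (hlam₁ : 0 < lam₁) (hlam₂ : 0 < lam₂)
    (μ : Measure (EuclideanSpace ℝ (Fin d))) [IsFiniteMeasure μ]
    (hcs : IsCompact (msupport μ)) (hpos : 0 < μ Set.univ)
    (γs : MultiCurve d)
    (hmin : ∀ γ : MultiCurve d, mppcEnergy μ p lam₁ lam₂ γs ≤ mppcEnergy μ p lam₁ lam₂ γ) :
    lam₁ * lam₂ * ((γs.k : ℝ) - 1) ≤ Metric.diam (msupport μ) ^ p * (μ Set.univ).toReal ∧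
    (γs.k : ℝ) ≤ 1 + Metric.diam (msupport μ) ^ p * (μ Set.univ).toReal / (lam₁ * lam₂) := by
  obtain ⟨x₀, hx₀⟩ : (msupport μ).Nonempty :=
    msupport_eq_support μ ▸ Measure.nonempty_support (Measure.measure_univ_pos.1 hpos)
  have h : lam₁ * lam₂ * ((γs.k : ℝ) - 1) ≤ diam (msupport μ) ^ p * (μ univ).toReal :=
    (le_mppcEnergy μ p lam₂ hlam₁.le γs).trans <| (hmin (MultiCurve.point x₀)).trans <|
      mppcEnergy_point_le μ lam₁ lam₂ (zero_le_one.trans hp) hcs.isBounded hx₀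
  refine ⟨h, ?_⟩
  rw [← sub_le_iff_le_add', le_div_iff₀' (mul_pos hlam₁ hlam₂)]
  exact h
end

section
/- Let K ⊆ ℝ^d be a nonempty closed convex set containing supp μ, and let π_K : ℝ^d → K denote the metric projection onto K. For any multiple curve γ = (γ¹, …, γᵏ), the multiple curve π_K ∘ γ := (π_K ∘ γ¹, …, π_K ∘ γᵏ) satisfies E(π_K ∘ γ) ≤ E(γ). (In particular, projecting a multiple curve onto the convex hull of the support of μ does not increase the MPPC energy.) -/
open MeasureTheory Metric Set

/-- The complement of `msupport μ` is a null set. -/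
theorem ae_mem_msupport {d : ℕ} (μ : Measure (EuclideanSpace ℝ (Fin d))) :
    ∀ᵐ x ∂μ, x ∈ msupport μ := by
  refine measure_null_of_locally_null _ fun x hx => ?_
  have hx' : ¬ ∀ ε > 0, 0 < μ (ball x ε) := hx
  push Not at hx'
  obtain ⟨ε, hε, h⟩ := hx'
  exact ⟨ball x ε, mem_nhdsWithin_of_mem_nhds (ball_mem_nhds x hε), le_antisymm h bot_le⟩

/-- A continuous real function is integrable for a finite measure with compact support. -/
theorem integrable_of_isCompact_msupport {d : ℕ} {μ : Measure (EuclideanSpace ℝ (Fin d))}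
    [IsFiniteMeasure μ] (hcs : IsCompact (msupport μ)) {f : EuclideanSpace ℝ (Fin d) → ℝ}
    (hf : Continuous f) : Integrable f μ := by
  have h := hf.continuousOn.integrableOn_compact (μ := μ) hcs
  rwa [IntegrableOn, Measure.restrict_eq_self_of_ae_mem (ae_mem_msupport μ)] at h

/-- The image of a multiple curve is nonempty. -/
theorem MultiCurve.image_nonempty {d : ℕ} (γ : MultiCurve d) : γ.image.Nonempty :=
  ⟨γ.curves ⟨0, γ.hk⟩ 0, mem_iUnion.2 ⟨_, mem_image_of_mem _ (by simp)⟩⟩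

/-- Each curve of a multiple curve has finite total variation. -/
theorem MultiCurve.eVariationOn_ne_top {d : ℕ} (γ : MultiCurve d) (i : Fin γ.k) :
    eVariationOn (γ.curves i) (Icc 0 1) ≠ ⊤ := by
  obtain ⟨C, hC⟩ := γ.lipschitz i
  simpa [BoundedVariationOn] using hC.locallyBoundedVariationOn 0 1 (by simp) (by simp)

/-- Composing the curves with a `1`-Lipschitz map does not increase the length. -/
theorem MultiCurve.length_comp_le {d : ℕ}
    {f : EuclideanSpace ℝ (Fin d) → EuclideanSpace ℝ (Fin d)} (hf : LipschitzWith 1 f)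
    (γ γ' : MultiCurve d) (hk : γ'.k = γ.k)
    (hcurves : ∀ i : Fin γ'.k, γ'.curves i = f ∘ γ.curves (Fin.cast hk i)) :
    γ'.length ≤ γ.length := by
  have hsum : γ.length = ∑ i : Fin γ'.k,
      (eVariationOn (γ.curves (Fin.cast hk i)) (Icc 0 1)).toReal :=
    ((finCongr hk).sum_comp fun i => (eVariationOn (γ.curves i) (Icc 0 1)).toReal).symm
  rw [hsum, MultiCurve.length]
  refine Finset.sum_le_sum fun i _ => ENNReal.toReal_mono (γ.eVariationOn_ne_top _) ?_
  rw [hcurves i]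
  simpa using hf.lipschitzOnWith.comp_eVariationOn_le
    (mapsTo_univ (γ.curves (Fin.cast hk i)) (Icc 0 1))

/-- Composing the curves with a `1`-Lipschitz map fixing `x` does not increase the distance from
`x` to the image. -/
theorem MultiCurve.infDist_image_comp_le {d : ℕ}
    {f : EuclideanSpace ℝ (Fin d) → EuclideanSpace ℝ (Fin d)} (hf : LipschitzWith 1 f)
    {x : EuclideanSpace ℝ (Fin d)} (hx : f x = x)
    (γ γ' : MultiCurve d) (hk : γ'.k = γ.k)
    (hcurves : ∀ i : Fin γ'.k, γ'.curves i = f ∘ γ.curves (Fin.cast hk i)) :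
    infDist x γ'.image ≤ infDist x γ.image := by
  refine (le_infDist γ.image_nonempty).2 fun y hy => ?_
  obtain ⟨i, t, ht, rfl⟩ := mem_iUnion.1 hy
  have hmem : f (γ.curves i t) ∈ γ'.image :=
    mem_iUnion.2 ⟨Fin.cast hk.symm i, t, ht, by rw [hcurves]; rfl⟩
  calc infDist x γ'.image ≤ dist x (f (γ.curves i t)) := infDist_le_dist_of_mem hmem
    _ = dist (f x) (f (γ.curves i t)) := by rw [hx]
    _ ≤ dist x (γ.curves i t) := by simpa using hf.dist_le_mul x (γ.curves i t)

/-- Projecting a multiple curve onto a nonempty closed convex set containing the support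
of the measure does not increase the MPPC energy. -/
theorem mppc_energy_proj_le (d : ℕ) (hd : 2 ≤ d) (p lam₁ lam₂ : ℝ)
    (hp : 1 ≤ p) (hlam₁ : 0 < lam₁) (hlam₂ : 0 < lam₂)
    (μ : Measure (EuclideanSpace ℝ (Fin d))) [IsFiniteMeasure μ]
    (hcs : IsCompact (msupport μ)) (hpos : 0 < μ Set.univ)
    (K : Set (EuclideanSpace ℝ (Fin d))) (hKne : K.Nonempty) (hKcl : IsClosed K)
    (hKconv : Convex ℝ K) (hsupp : msupport μ ⊆ K)
    (π : EuclideanSpace ℝ (Fin d) → EuclideanSpace ℝ (Fin d))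
    (hπmem : ∀ x, π x ∈ K)
    (hπnear : ∀ x, ∀ y ∈ K, dist x (π x) ≤ dist x y)
    (hπlip : LipschitzWith 1 π)
    (γ γ' : MultiCurve d) (hk : γ'.k = γ.k)
    (hcurves : ∀ i : Fin γ'.k, γ'.curves i = π ∘ γ.curves (Fin.cast hk i)) :
    mppcEnergy μ p lam₁ lam₂ γ' ≤ mppcEnergy μ p lam₁ lam₂ γ := by
  have hint : ∀ η : MultiCurve d, Integrable (fun x => infDist x η.image ^ p) μ := fun η =>
    integrable_of_isCompact_msupport hcs
      ((continuous_infDist_pt _).rpow_const fun _ => Or.inr (by linarith))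
  have hdist : ∫ x, infDist x γ'.image ^ p ∂μ ≤ ∫ x, infDist x γ.image ^ p ∂μ := by
    refine integral_mono_ae (hint γ') (hint γ) ?_
    filter_upwards [ae_mem_msupport μ] with x hx
    have hfix : π x = x := by
      have h := hπnear x x (hsupp hx)
      rw [dist_self] at h
      exact (dist_le_zero.1 h).symm
    exact Real.rpow_le_rpow infDist_nonneg
      (γ.infDist_image_comp_le hπlip hfix γ' hk hcurves) (by linarith)
  have hlen := γ.length_comp_le hπlip γ' hk hcurves
  rw [mppcEnergy, mppcEnergy, hk]
  gcongr
end

section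
/- Let γ = (γ¹, …, γᵏ) be a multiple curve with k ≥ 2 components. Define the concatenated curve γ̂ : [0,1] → ℝ^d by γ̂(t) = γ¹(3t) for t ∈ [0,1/3], γ̂(t) = γ¹(1) + (3t−1)(γ²(0) − γ¹(1)) for t ∈ [1/3,2/3], and γ̂(t) = γ²(3t−2) for t ∈ [2/3,1], and let γ' = (γ̂, γ³, …, γᵏ), a multiple curve with k−1 components. Then E(γ') ≤ E(γ) + λ₁ (|γ¹(1) − γ²(0)| − λ₂). In particular, if |γ¹(1) − γ²(0)| < λ₂, then E(γ') < E(γ): connecting two components whose endpoints are at distance less than λ₂ strictly decreases the MPPC energy. -/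
open MeasureTheory Metric Set

noncomputable section

/-- The concatenation of two curves `f, g : [0,1] → ℝ^d`: traverse `f`, then the line
segment from `f 1` to `g 0`, then `g`. -/
def concatCurve {d : ℕ} (f g : ℝ → EuclideanSpace ℝ (Fin d)) : ℝ → EuclideanSpace ℝ (Fin d) :=
  fun t =>
    if t ≤ 1 / 3 then f (3 * t)
    else if t ≤ 2 / 3 then f 1 + (3 * t - 1) • (g 0 - f 1)
    else g (3 * t - 2)

end

/-- The complement of the support is a null set. -/
theorem measure_compl_msupport {d : ℕ} (μ : Measure (EuclideanSpace ℝ (Fin d))) :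
    μ (msupport μ)ᶜ = 0 := by
  refine measure_null_of_locally_null _ fun x hx => ?_
  simp only [msupport, mem_compl_iff, mem_ofPred_eq, not_forall, not_lt, nonpos_iff_eq_zero] at hx
  obtain ⟨ε, hε, h⟩ := hx
  exact ⟨ball x ε, mem_nhdsWithin_of_mem_nhds (ball_mem_nhds x hε), h⟩

/-- Continuous functions are integrable against a finite measure with compact support. -/
theorem integrable_of_continuous_of_isCompact_msupport {d : ℕ}
    (μ : Measure (EuclideanSpace ℝ (Fin d))) [IsFiniteMeasure μ] (hcs : IsCompact (msupport μ))
    {f : EuclideanSpace ℝ (Fin d) → ℝ} (hf : Continuous f) : Integrable f μ := by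
  rw [← Measure.restrict_eq_self_of_ae_mem (s := msupport μ) (μ := μ)
    (measure_compl_msupport μ)]
  exact hf.continuousOn.integrableOn_compact hcs

section Concat

variable {d : ℕ} (f g : ℝ → EuclideanSpace ℝ (Fin d))

theorem concatCurve_eqOn_left :
    EqOn (concatCurve f g) (f ∘ fun t => 3 * t) (Icc 0 (1 / 3)) := by
  intro t ht
  simp only [concatCurve, if_pos ht.2, Function.comp]

theorem concatCurve_eqOn_middle :
    EqOn (concatCurve f g) ((fun s : ℝ => f 1 + s • (g 0 - f 1)) ∘ fun t => 3 * t - 1)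
      (Icc (1 / 3) (2 / 3)) := by
  intro t ht
  by_cases h : t ≤ 1 / 3
  · obtain rfl : t = 1 / 3 := le_antisymm h ht.1
    norm_num [concatCurve]
  · simp only [concatCurve, if_neg h, if_pos ht.2, Function.comp]

theorem concatCurve_eqOn_right :
    EqOn (concatCurve f g) (g ∘ fun t => 3 * t - 2) (Icc (2 / 3) 1) := by
  intro t ht
  have h : ¬ t ≤ 1 / 3 := by linarith [ht.1]
  by_cases h' : t ≤ 2 / 3
  · obtain rfl : t = 2 / 3 := le_antisymm h' ht.1
    norm_num [concatCurve]
  · simp only [concatCurve, if_neg h, if_neg h', Function.comp]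

theorem image_subset_image_concatCurve_left :
    f '' Icc 0 1 ⊆ concatCurve f g '' Icc 0 1 := by
  rintro _ ⟨t, ht, rfl⟩
  refine ⟨t / 3, ⟨by linarith [ht.1], by linarith [ht.2]⟩, ?_⟩
  rw [concatCurve_eqOn_left f g ⟨by linarith [ht.1], by linarith [ht.2]⟩, Function.comp]
  congr 1
  ring

theorem image_subset_image_concatCurve_right :
    g '' Icc 0 1 ⊆ concatCurve f g '' Icc 0 1 := by
  rintro _ ⟨t, ht, rfl⟩
  refine ⟨(t + 2) / 3, ⟨by linarith [ht.1], by linarith [ht.2]⟩, ?_⟩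
  rw [concatCurve_eqOn_right f g ⟨by linarith [ht.1], by linarith [ht.2]⟩, Function.comp]
  congr 1
  ring

theorem eVariationOn_segment_le :
    eVariationOn ((fun s : ℝ => f 1 + s • (g 0 - f 1)) ∘ fun t => 3 * t - 1)
      (Icc (1 / 3) (2 / 3)) ≤ edist (f 1) (g 0) := by
  have hL : LipschitzOnWith (nndist (f 1) (g 0)) (fun s : ℝ => f 1 + s • (g 0 - f 1)) univ := by
    refine LipschitzOnWith.of_dist_le_mul fun x _ y _ => ?_
    rw [dist_add_left, dist_eq_norm, ← sub_smul, norm_smul, coe_nndist, dist_comm (f 1),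
      dist_eq_norm (g 0), ← dist_eq_norm x y, dist_eq_norm, mul_comm]
  have hm : MonotoneOn (fun t : ℝ => 3 * t - 1) (Icc (1 / 3) (2 / 3)) :=
    fun x _ y _ h => by dsimp only; linarith
  have hv := hm.eVariationOn_eq (a := 1 / 3) (b := 2 / 3) (by norm_num) (by norm_num)
  rw [inter_self] at hv
  norm_num at hv
  refine (hL.comp_eVariationOn_le (mapsTo_univ _ _)).trans ?_
  rw [edist_nndist]
  calc _ ≤ (nndist (f 1) (g 0) : ENNReal) * 1 := by gcongr; norm_num [hv]
    _ = _ := mul_one _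

theorem eVariationOn_concatCurve_le :
    eVariationOn (concatCurve f g) (Icc 0 1) ≤
      eVariationOn f (Icc 0 1) + edist (f 1) (g 0) + eVariationOn g (Icc 0 1) := by
  have split₁ := eVariationOn.Icc_add_Icc (concatCurve f g) (s := univ)
    (a := 0) (b := 2 / 3) (c := 1) (by norm_num) (by norm_num) (mem_univ _)
  have split₂ := eVariationOn.Icc_add_Icc (concatCurve f g) (s := univ)
    (a := 0) (b := 1 / 3) (c := 2 / 3) (by norm_num) (by norm_num) (mem_univ _)
  simp only [univ_inter] at split₁ split₂
  rw [← split₁, ← split₂, eVariationOn.eq_of_eqOn (concatCurve_eqOn_left f g),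
    eVariationOn.eq_of_eqOn (concatCurve_eqOn_middle f g),
    eVariationOn.eq_of_eqOn (concatCurve_eqOn_right f g)]
  gcongr
  · exact eVariationOn.comp_le_of_monotoneOn _ _ (fun x _ y _ h => by linarith)
      fun t ht => ⟨by linarith [ht.1], by linarith [ht.2]⟩
  · exact eVariationOn_segment_le f g
  · exact eVariationOn.comp_le_of_monotoneOn _ _ (fun x _ y _ h => by linarith)
      fun t ht => ⟨by linarith [ht.1], by linarith [ht.2]⟩

end Concat

theorem eVariationOn_Icc_ne_top_of_lipschitzOnWith {E : Type*} [PseudoEMetricSpace E] {f : ℝ → E}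
    {C : NNReal} {a b : ℝ} (hab : a ≤ b) (hf : LipschitzOnWith C f (Icc a b)) :
    eVariationOn f (Icc a b) ≠ ⊤ := by
  simpa [BoundedVariationOn] using hf.locallyBoundedVariationOn a b (left_mem_Icc.2 hab) (right_mem_Icc.2 hab)

theorem eVariationOn_concatCurve_toReal_le {d : ℕ} {f g : ℝ → EuclideanSpace ℝ (Fin d)}
    (hf : eVariationOn f (Icc 0 1) ≠ ⊤) (hg : eVariationOn g (Icc 0 1) ≠ ⊤) :
    (eVariationOn (concatCurve f g) (Icc 0 1)).toReal ≤
      (eVariationOn f (Icc 0 1)).toReal + dist (f 1) (g 0) + (eVariationOn g (Icc 0 1)).toReal := by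
  have hd := edist_ne_top (f 1) (g 0)
  have h := ENNReal.toReal_mono (by finiteness) (eVariationOn_concatCurve_le f g)
  rwa [ENNReal.toReal_add (by finiteness) hg, ENNReal.toReal_add hf hd, ← dist_edist] at h

/-- Enlarging the image decreases the fidelity term. -/
theorem integral_infDist_rpow_anti {d : ℕ} (μ : Measure (EuclideanSpace ℝ (Fin d)))
    [IsFiniteMeasure μ] (hcs : IsCompact (msupport μ)) {p : ℝ} (hp : 0 ≤ p)
    {s t : Set (EuclideanSpace ℝ (Fin d))} (hs : s.Nonempty) (hst : s ⊆ t) :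
    ∫ x, infDist x t ^ p ∂μ ≤ ∫ x, infDist x s ^ p ∂μ := by
  have hint (u : Set (EuclideanSpace ℝ (Fin d))) : Integrable (fun x => infDist x u ^ p) μ :=
    integrable_of_continuous_of_isCompact_msupport μ hcs
      ((continuous_infDist_pt u).rpow_const fun _ => Or.inr hp)
  exact integral_mono (hint t) (hint s) fun x =>
    Real.rpow_le_rpow infDist_nonneg (infDist_le_infDist_of_subset hst hs) hp

/-- Connecting two components of a multiple curve by a line segment between their endpoints
changes the MPPC energy by at most `λ₁ (|γ¹(1) − γ²(0)| − λ₂)`; in particular, if the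
endpoints are at distance less than `λ₂`, connecting strictly decreases the energy. -/
theorem mppc_energy_connect (d : ℕ) (hd : 2 ≤ d) (p lam₁ lam₂ : ℝ)
    (hp : 1 ≤ p) (hlam₁ : 0 < lam₁) (hlam₂ : 0 < lam₂)
    (μ : Measure (EuclideanSpace ℝ (Fin d))) [IsFiniteMeasure μ]
    (hcs : IsCompact (msupport μ)) (hpos : 0 < μ Set.univ)
    (γ γ' : MultiCurve d) (h2 : 2 ≤ γ.k) (hk' : γ'.k = γ.k - 1)
    (h0 : γ'.curves ⟨0, γ'.hk⟩ = concatCurve (γ.curves ⟨0, γ.hk⟩) (γ.curves ⟨1, h2⟩))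
    (hrest : ∀ j : ℕ, ∀ (hj2 : 2 ≤ j) (hjk : j < γ.k),
      γ'.curves ⟨j - 1, by omega⟩ = γ.curves ⟨j, hjk⟩) :
    mppcEnergy μ p lam₁ lam₂ γ' ≤ mppcEnergy μ p lam₁ lam₂ γ
      + lam₁ * (dist (γ.curves ⟨0, γ.hk⟩ 1) (γ.curves ⟨1, h2⟩ 0) - lam₂) ∧
    (dist (γ.curves ⟨0, γ.hk⟩ 1) (γ.curves ⟨1, h2⟩ 0) < lam₂ →
      mppcEnergy μ p lam₁ lam₂ γ' < mppcEnergy μ p lam₁ lam₂ γ) := by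
  have hlen : γ'.length ≤
      γ.length + dist (γ.curves ⟨0, γ.hk⟩ 1) (γ.curves ⟨1, h2⟩ 0) := by
    have hfin i : eVariationOn (γ.curves i) (Icc 0 1) ≠ ⊤ :=
      eVariationOn_Icc_ne_top_of_lipschitzOnWith zero_le_one (γ.lipschitz i).choose_spec
    have hc := eVariationOn_concatCurve_toReal_le (hfin ⟨0, γ.hk⟩) (hfin ⟨1, h2⟩)
    rw [← h0] at hc
    clear hfin
    obtain ⟨k, hk, c, hc'⟩ := γ
    obtain ⟨k', hk₂, c', hc''⟩ := γ'
    dsimp only at *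
    obtain ⟨m, rfl⟩ := Nat.exists_eq_add_of_le' h2
    obtain rfl : k' = m + 1 := hk'
    have htail (i : Fin m) : c' i.succ = c i.succ.succ := hrest (i + 2) (by omega) (by omega)
    simp only [MultiCurve.length]
    rw [Fin.sum_univ_succ, Fin.sum_univ_succ (n := m + 1), Fin.sum_univ_succ (n := m)]
    simp only [htail]
    change (eVariationOn (c' 0) _).toReal ≤ (eVariationOn (c 0) _).toReal + _ +
      (eVariationOn (c (Fin.succ 0)) _).toReal at hc
    linarith
  have hsub : γ.image ⊆ γ'.image := by
    refine iUnion_subset fun ⟨j, hj⟩ => ?_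
    match j, hj with
    | 0, hj =>
      refine Subset.trans ?_ (subset_iUnion _ ⟨0, γ'.hk⟩)
      rw [h0]
      exact image_subset_image_concatCurve_left _ _
    | 1, hj =>
      refine Subset.trans ?_ (subset_iUnion _ ⟨0, γ'.hk⟩)
      rw [h0]
      exact image_subset_image_concatCurve_right _ _
    | j + 2, hj =>
      rw [← hrest (j + 2) (by omega) hj]
      exact subset_iUnion (fun i => γ'.curves i '' Icc 0 1) _
  have hfid := integral_infDist_rpow_anti μ hcs (zero_le_one.trans hp) γ.image_nonempty hsub
  have hcomp : (γ'.k : ℝ) = γ.k - 1 := by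
    rw [hk', Nat.cast_sub γ.hk, Nat.cast_one]
  have hle : mppcEnergy μ p lam₁ lam₂ γ' ≤ mppcEnergy μ p lam₁ lam₂ γ
      + lam₁ * (dist (γ.curves ⟨0, γ.hk⟩ 1) (γ.curves ⟨1, h2⟩ 0) - lam₂) := by
    unfold mppcEnergy
    rw [hcomp]
    linarith [mul_le_mul_of_nonneg_left hlen hlam₁.le]
  refine ⟨hle, fun h => hle.trans_lt ?_⟩
  linarith [mul_neg_of_pos_of_neg hlam₁ (sub_neg.2 h)]
end

section
/- (Rearrangement invariance, Lemma A.1.) Let γ̄ = ⋃_{i=1}^{c+1} [āᵢ, b̄ᵢ] and γ̃ = ⋃_{i=1}^{c+1} [ãᵢ, b̃ᵢ] be two segment configurations, each with c gaps, such that there exists a permutation σ of {1, …, c} with ḡᵢ = g̃_{σ(i)} for all i = 1, …, c (the gap sequences agree up to permutation). Then E(γ̄) = E(γ̃): the energy is invariant under redistribution of the total length among the segments as long as the multiset of gap sizes and the number of components are unchanged. -/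
open MeasureTheory Metric Set

/-- `a b : Fin (c+1) → ℝ` describe a segment configuration
`⋃ i, [a i, b i]` in `[0, L]` with `c` gaps. -/
def IsSegConfig (L : ℝ) (c : ℕ) (a b : Fin (c + 1) → ℝ) : Prop :=
  a 0 = 0 ∧ b (Fin.last c) = L ∧ (∀ i, a i ≤ b i) ∧
    ∀ i : Fin c, b i.castSucc ≤ a i.succ

/-- The energy of a segment configuration for data of uniform density `α` on `[0, L]`. -/
noncomputable def segEnergy (p lam₁ lam₂ α L : ℝ) (c : ℕ) (a b : Fin (c + 1) → ℝ) : ℝ :=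
  α * (∫ x in Set.Icc (0 : ℝ) L, Metric.infDist x (⋃ i, Set.Icc (a i) (b i)) ^ p)
    + lam₁ * ((∑ i, (b i - a i)) + lam₂ * c)

/-- Telescoping of the increments of `F` over the segments and the gaps. -/
lemma sum_segments_add_sum_gaps (F : ℝ → ℝ) (c : ℕ) (a b : Fin (c + 1) → ℝ) :
    (∑ i, (F (b i) - F (a i))) + ∑ i : Fin c, (F (a i.succ) - F (b i.castSucc))
      = F (b (Fin.last c)) - F (a 0) := by
  rw [Finset.sum_sub_distrib, Finset.sum_sub_distrib, Fin.sum_univ_castSucc (fun i => F (b i)),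
    Fin.sum_univ_succ (fun i => F (a i))]
  ring

namespace IsSegConfig

variable {L : ℝ} {c : ℕ} {a b : Fin (c + 1) → ℝ}

lemma monotone_left (h : IsSegConfig L c a b) : Monotone a :=
  Fin.monotone_iff_le_succ.2 fun i => (h.2.2.1 i.castSucc).trans (h.2.2.2 i)

lemma monotone_right (h : IsSegConfig L c a b) : Monotone b :=
  Fin.monotone_iff_le_succ.2 fun i => (h.2.2.2 i).trans (h.2.2.1 i.succ)

/-- Inside a gap, the nearest point of the configuration is one of the two gap ends. -/
lemma infDist_of_mem_gap (h : IsSegConfig L c a b) (i : Fin c) {x : ℝ}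
    (hx : x ∈ Set.Icc (b i.castSucc) (a i.succ)) :
    Metric.infDist x (⋃ j, Set.Icc (a j) (b j)) = min (x - b i.castSucc) (a i.succ - x) := by
  have hb : b i.castSucc ∈ ⋃ j, Set.Icc (a j) (b j) :=
    Set.mem_iUnion.2 ⟨i.castSucc, h.2.2.1 _, le_rfl⟩
  have ha : a i.succ ∈ ⋃ j, Set.Icc (a j) (b j) :=
    Set.mem_iUnion.2 ⟨i.succ, le_rfl, h.2.2.1 _⟩
  refine le_antisymm (le_min ?_ ?_) ((Metric.le_infDist ⟨_, hb⟩).2 fun y hy => ?_)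
  · refine (Metric.infDist_le_dist_of_mem hb).trans_eq ?_
    rw [Real.dist_eq, abs_of_nonneg (sub_nonneg.2 hx.1)]
  · refine (Metric.infDist_le_dist_of_mem ha).trans_eq ?_
    rw [dist_comm, Real.dist_eq, abs_of_nonneg (sub_nonneg.2 hx.2)]
  · obtain ⟨j, hj⟩ := Set.mem_iUnion.1 hy
    rw [Real.dist_eq]
    rcases le_or_gt j i.castSucc with hji | hji
    · have := h.monotone_right hji
      exact (min_le_left _ _).trans (by linarith [le_abs_self (x - y), hj.2])
    · have := h.monotone_left (Fin.castSucc_lt_iff_succ_le.1 hji)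
      exact (min_le_right _ _).trans (by linarith [neg_le_abs (x - y), hj.1])

/-- The fidelity integral depends only on the gap sizes. -/
lemma integral_infDist_rpow (h : IsSegConfig L c a b) (hL : 0 ≤ L) {p : ℝ} (hp : 0 < p) :
    ∫ x in Set.Icc (0 : ℝ) L, Metric.infDist x (⋃ i, Set.Icc (a i) (b i)) ^ p
      = ∑ i : Fin c, ∫ t in (0 : ℝ)..(a i.succ - b i.castSucc),
          min t (a i.succ - b i.castSucc - t) ^ p := by
  set f : ℝ → ℝ := fun x => Metric.infDist x (⋃ i, Set.Icc (a i) (b i)) ^ p with hf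
  have hint (u v : ℝ) : IntervalIntegrable f volume u v :=
    ((Metric.continuous_infDist_pt _).rpow_const fun _ => Or.inr hp.le).intervalIntegrable u v
  have hsub (u v : ℝ) : (∫ x in (0 : ℝ)..v, f x) - ∫ x in (0 : ℝ)..u, f x = ∫ x in u..v, f x :=
    intervalIntegral.integral_interval_sub_left (hint _ _) (hint _ _)
  have hseg (i : Fin (c + 1)) : ∫ x in a i..b i, f x = 0 := by
    refine (intervalIntegral.integral_congr (g := fun _ => 0) fun x hx => ?_).trans
      intervalIntegral.integral_zero
    rw [Set.uIcc_of_le (h.2.2.1 i)] at hx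
    simp only [hf]
    rw [Metric.infDist_zero_of_mem (Set.mem_iUnion.2 ⟨i, hx⟩), Real.zero_rpow hp.ne']
  have hgap (i : Fin c) : ∫ x in b i.castSucc..a i.succ, f x
      = ∫ t in (0 : ℝ)..(a i.succ - b i.castSucc), min t (a i.succ - b i.castSucc - t) ^ p := by
    have hshift := intervalIntegral.integral_comp_sub_right (a := b i.castSucc) (b := a i.succ)
      (fun t => min t (a i.succ - b i.castSucc - t) ^ p) (b i.castSucc)
    rw [sub_self] at hshift
    rw [← hshift]
    refine intervalIntegral.integral_congr fun x hx => ?_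
    rw [Set.uIcc_of_le (h.2.2.2 i)] at hx
    simp only [hf]
    rw [h.infDist_of_mem_gap i hx, sub_sub_sub_cancel_right]
  have key := sum_segments_add_sum_gaps (fun v => ∫ x in (0 : ℝ)..v, f x) c a b
  simp only [hsub, hseg, hgap, Finset.sum_const_zero, zero_add, h.1, h.2.1] at key
  rw [MeasureTheory.integral_Icc_eq_integral_Ioc, ← intervalIntegral.integral_of_le hL, key]

/-- The total length of the segments is `L` minus the total gap size. -/
lemma sum_length (h : IsSegConfig L c a b) :
    ∑ i, (b i - a i) = L - ∑ i : Fin c, (a i.succ - b i.castSucc) := by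
  have key := sum_segments_add_sum_gaps id c a b
  simp only [id, h.1, h.2.1] at key
  linarith

end IsSegConfig

/-- Rearrangement invariance (Lemma A.1): two segment configurations with the same number of
gaps whose gap sequences agree up to a permutation have the same energy. -/
theorem segEnergy_rearrange (p lam₁ lam₂ α L : ℝ) (hp : 1 ≤ p) (hlam₁ : 0 < lam₁)
    (hlam₂ : 0 < lam₂) (hα : 0 < α) (hL : 0 < L) (c : ℕ)
    (a₁ b₁ a₂ b₂ : Fin (c + 1) → ℝ)
    (hconf₁ : IsSegConfig L c a₁ b₁) (hconf₂ : IsSegConfig L c a₂ b₂)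
    (σ : Equiv.Perm (Fin c))
    (hgap : ∀ i : Fin c, a₁ i.succ - b₁ i.castSucc = a₂ (σ i).succ - b₂ (σ i).castSucc) :
    segEnergy p lam₁ lam₂ α L c a₁ b₁ = segEnergy p lam₁ lam₂ α L c a₂ b₂ := by
  simp only [segEnergy, hconf₁.integral_infDist_rpow hL.le (zero_lt_one.trans_le hp),
    hconf₂.integral_infDist_rpow hL.le (zero_lt_one.trans_le hp), hconf₁.sum_length,
    hconf₂.sum_length, hgap]
  rw [Equiv.sum_comp σ (fun i => a₂ i.succ - b₂ i.castSucc),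
    Equiv.sum_comp σ (fun i => ∫ t in (0 : ℝ)..(a₂ i.succ - b₂ i.castSucc),
      min t (a₂ i.succ - b₂ i.castSucc - t) ^ p)]
end

section
/- Fix reals p ≥ 1, λ₁ > 0, λ₂ > 0, α > 0, L > 0 and an integer k ≥ 1 with 2(λ₁/α)^{1/p} ≤ L/k. Then the minimum over l ∈ [0, L/k] of λ₁ k l + (2α/(p+1)) k ((L − k l)/(2k))^{p+1} + λ₁ λ₂ k equals λ₁ L + λ₁ λ₂ k − (2p/(p+1)) λ₁ (λ₁/α)^{1/p} k, and it is attained at l* = L/k − 2(λ₁/α)^{1/p}. -/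
open Set

/-- The graph of `x ↦ x ^ q` with `1 ≤ q` lies above its tangent line at `a > 0`. -/
theorem Real.rpow_tangent_le {a g q : ℝ} (ha : 0 < a) (hg : 0 ≤ g) (hq : 1 ≤ q) :
    a ^ (q - 1) * (a + q * (g - a)) ≤ g ^ q := by
  have hb := one_add_mul_self_le_rpow_one_add (s := g / a - 1)
    (by linarith [div_nonneg hg ha.le]) hq
  rw [add_sub_cancel, Real.div_rpow hg ha.le, le_div_iff₀ (Real.rpow_pos_of_pos ha q)] at hb
  refine le_of_eq_of_le ?_ hb
  rw [Real.rpow_sub_one ha.ne']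
  field_simp

/-- If `2(λ₁/α)^{1/p} ≤ L/k`, the minimum over `l ∈ [0, L/k]` of the energy
`λ₁ k l + (2α/(p+1)) k ((L − kl)/(2k))^{p+1} + λ₁ λ₂ k` of `k` segments of common length `l`
with `k` uniform gaps equals `λ₁ L + λ₁ λ₂ k − (2p/(p+1)) λ₁ (λ₁/α)^{1/p} k`, attained at
`l* = L/k − 2(λ₁/α)^{1/p}`. -/
theorem segEnergy_fixed_k_min_value (p lam₁ lam₂ α L : ℝ) (hp : 1 ≤ p) (hlam₁ : 0 < lam₁)
    (hlam₂ : 0 < lam₂) (hα : 0 < α) (hL : 0 < L) (k : ℕ) (hk : 1 ≤ k)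
    (hcrit : 2 * (lam₁ / α) ^ (1 / p) ≤ L / k) :
    let F : ℝ → ℝ := fun l =>
      lam₁ * k * l + (2 * α / (p + 1)) * k * ((L - k * l) / (2 * k)) ^ (p + 1)
        + lam₁ * lam₂ * k
    let lstar : ℝ := L / k - 2 * (lam₁ / α) ^ (1 / p)
    lstar ∈ Set.Icc (0 : ℝ) (L / k) ∧
    F lstar = lam₁ * L + lam₁ * lam₂ * k - (2 * p / (p + 1)) * lam₁ * (lam₁ / α) ^ (1 / p) * k ∧
    ∀ l ∈ Set.Icc (0 : ℝ) (L / k), F lstar ≤ F l := by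
  intro F lstar
  have hk₀ : (0 : ℝ) < k := by exact_mod_cast hk
  have hp₁ : 0 < p + 1 := by linarith
  have ha : 0 < (lam₁ / α) ^ (1 / p) := Real.rpow_pos_of_pos (div_pos hlam₁ hα) _
  have hap : ((lam₁ / α) ^ (1 / p)) ^ p = lam₁ / α := by
    rw [one_div, Real.rpow_inv_rpow (div_pos hlam₁ hα).le (by linarith)]
  set a := (lam₁ / α) ^ (1 / p)
  have hmin : F lstar = lam₁ * L + lam₁ * lam₂ * k - (2 * p / (p + 1)) * lam₁ * a * k := by
    have hgap : (L - k * lstar) / (2 * k) = a := by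
      simp only [lstar]
      field_simp
      ring
    simp only [F]
    rw [hgap, Real.rpow_add_one ha.ne', hap]
    simp only [lstar]
    field_simp
    ring
  refine ⟨⟨sub_nonneg.2 hcrit, by simp only [lstar]; linarith⟩, hmin, fun l hl => ?_⟩
  rw [hmin]
  have hkl : k * l ≤ L := by
    have := (le_div_iff₀ hk₀).1 hl.2
    linarith
  obtain ⟨g, hg⟩ : ∃ g, g = (L - k * l) / (2 * k) := ⟨_, rfl⟩
  have hg₀ : 0 ≤ g := hg ▸ div_nonneg (sub_nonneg.2 hkl) (by positivity)
  have hl' : k * l = L - 2 * k * g := by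
    rw [hg]
    field_simp
    ring
  have ht := Real.rpow_tangent_le ha hg₀ (by linarith : 1 ≤ p + 1)
  rw [add_sub_cancel_right, hap] at ht
  have hmul := mul_le_mul_of_nonneg_left ht
    (by positivity : 0 ≤ (2 * α / (p + 1)) * k)
  have hval : (2 * α / (p + 1)) * k * (lam₁ / α * (a + (p + 1) * (g - a))) =
      2 * lam₁ * k * g - (2 * p / (p + 1)) * lam₁ * a * k := by
    field_simp
    ring
  simp only [F]
  rw [← hg, mul_assoc lam₁ (k : ℝ) l, hl']
  linarith
end

section
/- (One-component optimality above the critical density.) Fix reals p ≥ 1, λ₁ > 0, λ₂ > 0, α > 0, L > 0 with λ₂ ≥ (2p/(p+1)) (λ₁/α)^{1/p}. Then for every integer k ≥ 1 and every l ∈ [0, L/k], λ₁ k l + (2α/(p+1)) k ((L − k l)/(2k))^{p+1} + λ₁ λ₂ k ≥ λ₁ L. That is, every configuration of k+1 ≥ 2 components (k segments of length l with k uniform gaps) has energy at least that of the single full segment [0, L], whose energy is λ₁ L. -/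
open Set

/-- The tangent line inequality for `x ↦ x ^ (p + 1)` at `c > 0`. -/
theorem add_one_mul_mul_rpow_le {p c h : ℝ} (hp : 0 ≤ p) (hc : 0 < c) (hh : 0 ≤ h) :
    (p + 1) * (h * c ^ p) ≤ h ^ (p + 1) + p * (c * c ^ p) := by
  have ht : 0 ≤ h / c := by positivity
  have hb := one_add_mul_self_le_rpow_one_add (s := h / c - 1) (by linarith)
    (p := p + 1) (by linarith)
  rw [add_sub_cancel, Real.div_rpow hh hc.le, Real.rpow_add_one hc.ne',
    le_div_iff₀ (by positivity)] at hb
  have key : (1 + (p + 1) * (h / c - 1)) * (c ^ p * c)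
      = (p + 1) * (h * c ^ p) - p * (c * c ^ p) := by
    field_simp
    ring
  linarith

/-- One-component optimality above the critical density: if
`λ₂ ≥ (2p/(p+1))(λ₁/α)^{1/p}`, then for every `k ≥ 1` and `l ∈ [0, L/k]` the energy of the
configuration of `k` segments of common length `l` with `k` uniform gaps is at least `λ₁ L`,
the energy of the single full segment `[0, L]`. -/
theorem one_component_optimal (p lam₁ lam₂ α L : ℝ) (hp : 1 ≤ p) (hlam₁ : 0 < lam₁)
    (hlam₂ : 0 < lam₂) (hα : 0 < α) (hL : 0 < L)
    (hcrit : (2 * p / (p + 1)) * (lam₁ / α) ^ (1 / p) ≤ lam₂) :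
    ∀ k : ℕ, 1 ≤ k → ∀ l ∈ Set.Icc (0 : ℝ) (L / k),
      lam₁ * L ≤ lam₁ * k * l + (2 * α / (p + 1)) * k * ((L - k * l) / (2 * k)) ^ (p + 1)
        + lam₁ * lam₂ * k := by
  intro k hk l hl
  have hk0 : (0 : ℝ) < k := by exact_mod_cast hk
  have hlk : k * l ≤ L := by
    have := (le_div_iff₀ hk0).1 hl.2
    linarith
  set h := (L - k * l) / (2 * k) with hh
  have hh0 : 0 ≤ h := div_nonneg (by linarith) (by positivity)
  have hgap : L = k * l + 2 * k * h := by
    rw [hh]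
    field_simp
    ring
  set c := (lam₁ / α) ^ (1 / p) with hc
  have hc0 : 0 < c := by positivity
  have hcp : c ^ p = lam₁ / α := by
    rw [hc, ← Real.rpow_mul (by positivity), one_div_mul_cancel (by positivity), Real.rpow_one]
  have htan := add_one_mul_mul_rpow_le (by linarith : 0 ≤ p) hc0 hh0
  rw [hcp] at htan
  have hgain : 2 * h * lam₁ ≤ 2 * α / (p + 1) * h ^ (p + 1) + lam₁ * (2 * p / (p + 1) * c) := by
    have := mul_le_mul_of_nonneg_left htan (by positivity : 0 ≤ 2 * α / (p + 1))
    have e₁ : 2 * α / (p + 1) * ((p + 1) * (h * (lam₁ / α))) = 2 * h * lam₁ := by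
      field_simp
    have e₂ : 2 * α / (p + 1) * (h ^ (p + 1) + p * (c * (lam₁ / α)))
        = 2 * α / (p + 1) * h ^ (p + 1) + lam₁ * (2 * p / (p + 1) * c) := by
      field_simp
    linarith
  have hcomp := mul_le_mul_of_nonneg_left hcrit hlam₁.le
  have hbound := hgain.trans (add_le_add_right hcomp _)
  calc lam₁ * L = lam₁ * k * l + k * (2 * h * lam₁) := by
        rw [hgap]
        ring
    _ ≤ lam₁ * k * l + k * (2 * α / (p + 1) * h ^ (p + 1) + lam₁ * lam₂) := by gcongr
    _ = _ := by ring
end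

section
/- (Breakup below the critical density.) Fix reals p ≥ 1, λ₁ > 0, λ₂ > 0, α > 0, L > 0 with λ₂ < (2p/(p+1)) (λ₁/α)^{1/p} and L > 2 (λ₁/α)^{1/p}. Then the two-component configuration with k = 1 and l = L − 2(λ₁/α)^{1/p} satisfies λ₁ l + (2α/(p+1)) ((L − l)/2)^{p+1} + λ₁ λ₂ = λ₁ L + λ₁ λ₂ − (2p/(p+1)) λ₁ (λ₁/α)^{1/p} < λ₁ L. That is, there is a disconnected configuration with strictly smaller energy than the single full segment [0, L]. -/
open Set

/-- Breakup below the critical density: if `λ₂ < (2p/(p+1))(λ₁/α)^{1/p}` and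
`L > 2(λ₁/α)^{1/p}`, then the two-component configuration with one gap (`k = 1`,
`l = L − 2(λ₁/α)^{1/p}`) has energy
`λ₁ L + λ₁ λ₂ − (2p/(p+1)) λ₁ (λ₁/α)^{1/p}`, which is strictly less than `λ₁ L`,
the energy of the single full segment `[0, L]`. -/
theorem breakup_below_critical_density (p lam₁ lam₂ α L : ℝ) (hp : 1 ≤ p) (hlam₁ : 0 < lam₁)
    (hlam₂ : 0 < lam₂) (hα : 0 < α) (hL : 0 < L)
    (hcrit : lam₂ < (2 * p / (p + 1)) * (lam₁ / α) ^ (1 / p))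
    (hLbig : 2 * (lam₁ / α) ^ (1 / p) < L) :
    let l : ℝ := L - 2 * (lam₁ / α) ^ (1 / p)
    lam₁ * l + (2 * α / (p + 1)) * ((L - l) / 2) ^ (p + 1) + lam₁ * lam₂
        = lam₁ * L + lam₁ * lam₂ - (2 * p / (p + 1)) * lam₁ * (lam₁ / α) ^ (1 / p) ∧
    lam₁ * L + lam₁ * lam₂ - (2 * p / (p + 1)) * lam₁ * (lam₁ / α) ^ (1 / p) < lam₁ * L := by
  intro l
  have hq : 0 < lam₁ / α := div_pos hlam₁ hα
  have hg : 0 < (lam₁ / α) ^ (1 / p) := Real.rpow_pos_of_pos hq _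
  have hgp : ((lam₁ / α) ^ (1 / p)) ^ p = lam₁ / α := by
    rw [one_div, Real.rpow_inv_rpow hq.le (by linarith)]
  have hgap : (L - l) / 2 = (lam₁ / α) ^ (1 / p) := by
    simp only [l]
    ring
  have hp1 : p + 1 ≠ 0 := by linarith
  constructor
  · rw [hgap, Real.rpow_add_one hg.ne', hgp]
    simp only [l]
    field_simp
    ring
  · have h := mul_lt_mul_of_pos_left hcrit hlam₁
    linarith
end

section
/- (Linear stability.) Let λ₁ > 0 and a < b be reals. Let α, H : [a,b] → [0, ∞) be measurable functions with α integrable, such that 2 α(s) H(s)² ≤ λ₁ for almost every s ∈ [a,b]. Then for every Lipschitz function v : [a,b] → ℝ with v(a) = v(b) = 0 that is not identically zero, the second-variation quadratic form is strictly positive: ∫_a^b ( (λ₁ − 2 α(s) H(s)²) v'(s)² + 2 α(s) v(s)² ) ds > 0. -/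
open MeasureTheory Set

/-- Linear stability: if `2 α(s) H(s)² ≤ λ₁` a.e. on `[a,b]`, then for every Lipschitz
perturbation `v` vanishing at the endpoints and not identically zero on `[a,b]`, the
second-variation quadratic form `∫ (λ₁ − 2αH²)(v')² + 2α v²` is strictly positive. -/
theorem second_variation_pos_of_stable (lam₁ a b : ℝ) (hlam₁ : 0 < lam₁) (hab : a < b)
    (α H : ℝ → ℝ) (hαmeas : Measurable α) (hHmeas : Measurable H)
    (hαnn : ∀ s ∈ Set.Icc a b, 0 ≤ α s) (hHnn : ∀ s ∈ Set.Icc a b, 0 ≤ H s)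
    (hαint : IntegrableOn α (Set.Icc a b))
    (hstab : ∀ᵐ s ∂(volume.restrict (Set.Icc a b)), 2 * α s * H s ^ 2 ≤ lam₁)
    (v : ℝ → ℝ) (hv : ∃ C : NNReal, LipschitzOnWith C v (Set.Icc a b))
    (hva : v a = 0) (hvb : v b = 0) (hvne : ∃ s ∈ Set.Icc a b, v s ≠ 0) :
    0 < ∫ s in Set.Icc a b,
      ((lam₁ - 2 * α s * H s ^ 2) * deriv v s ^ 2 + 2 * α s * v s ^ 2) := by
  obtain ⟨C, hC⟩ := hv
  have hvc : ContinuousOn v (Icc a b) := hC.continuousOn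
  have hIoo : ∀ᵐ s ∂(volume.restrict (Icc a b)), s ∈ Ioo a b := by
    rw [← restrict_Ioo_eq_restrict_Icc]
    exact ae_restrict_mem measurableSet_Ioo
  have hdiff : ∀ᵐ s ∂(volume.restrict (Icc a b)), DifferentiableAt ℝ v s := by
    filter_upwards [ae_restrict_of_ae hC.ae_differentiableWithinAt_of_mem_real, hIoo]
      with s hs hmem
    exact (hs (Ioo_subset_Icc_self hmem)).differentiableAt (Icc_mem_nhds hmem.1 hmem.2)
  have hgrad : IntegrableOn (fun s => (lam₁ - 2 * α s * H s ^ 2) * deriv v s ^ 2) (Icc a b) := by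
    refine Measure.integrableOn_of_bounded (M := lam₁ * C ^ 2) (by simp) ?_ ?_
    · exact (((measurable_const.sub ((measurable_const.mul hαmeas).mul (hHmeas.pow_const 2))).mul
        ((measurable_deriv v).pow_const 2))).aestronglyMeasurable
    · filter_upwards [hstab, hIoo] with s hs hmem
      have hα := hαnn s (Ioo_subset_Icc_self hmem)
      have hd : |deriv v s| ≤ C :=
        norm_deriv_le_of_lipschitzOn (Icc_mem_nhds hmem.1 hmem.2) hC
      have hd2 : deriv v s ^ 2 ≤ (C : ℝ) ^ 2 := sq_le_sq' (abs_le.1 hd).1 (abs_le.1 hd).2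
      have hαH : 0 ≤ 2 * α s * H s ^ 2 := by positivity
      rw [Real.norm_of_nonneg (mul_nonneg (by linarith) (sq_nonneg _))]
      gcongr
      linarith
  have hpot : IntegrableOn (fun s => 2 * α s * v s ^ 2) (Icc a b) :=
    IntegrableOn.mul_continuousOn (hαint.const_mul 2) (hvc.pow 2) isCompact_Icc
  have hnn : ∀ᵐ s ∂(volume.restrict (Icc a b)),
      0 ≤ (lam₁ - 2 * α s * H s ^ 2) * deriv v s ^ 2 + 2 * α s * v s ^ 2 := by
    filter_upwards [hstab, hIoo] with s hs hmem
    have hα := hαnn s (Ioo_subset_Icc_self hmem)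
    exact add_nonneg (mul_nonneg (by linarith) (sq_nonneg _)) (by positivity)
  refine (integral_nonneg_of_ae hnn).lt_of_ne' fun hzero => ?_
  rw [integral_eq_zero_iff_of_nonneg_ae hnn (hgrad.add hpot)] at hzero
  have hderiv : ∀ᵐ s ∂(volume.restrict (Icc a b)), HasDerivAt (fun s => v s * v s) 0 s := by
    filter_upwards [hzero, hstab, hIoo, hdiff] with s hz hs hmem hd
    have hα := hαnn s (Ioo_subset_Icc_self hmem)
    suffices h : deriv v s * v s + v s * deriv v s = 0 from
      h ▸ hd.hasDerivAt.mul hd.hasDerivAt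
    by_cases hvs : v s = 0
    · simp [hvs]
    · have hv2 : 0 < v s ^ 2 := by positivity
      have h1 : 0 ≤ (lam₁ - 2 * α s * H s ^ 2) * deriv v s ^ 2 :=
        mul_nonneg (by linarith) (sq_nonneg _)
      simp only [Pi.zero_apply] at hz
      have hα0 : α s = 0 := by nlinarith [mul_nonneg hα hv2.le]
      have hd0 : deriv v s = 0 := by simpa [hα0, hlam₁.ne'] using hz
      simp [hd0]
  have hac : AbsolutelyContinuousOnInterval v a b := by
    refine LipschitzOnWith.absolutelyContinuousOnInterval (K := C) ?_
    rwa [uIcc_of_le hab.le]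
  obtain ⟨c, hc⟩ := (hac.fun_mul hac).const_of_ae_hasDerivAt_zero (by
    rw [uIcc_of_le hab.le]
    exact (ae_restrict_iff' measurableSet_Icc).1 hderiv)
  rw [uIcc_of_le hab.le] at hc
  obtain ⟨s, hs, hvs⟩ := hvne
  have hsa := (hc s hs).trans (hc a (left_mem_Icc.2 hab.le)).symm
  simp [hva, hvs] at hsa
end

section
/- (Linear instability.) Let λ₁ > 0 and a < b be reals. Let α, H : [a,b] → [0, ∞) be continuous functions with λ₁ < 2 α(s) H(s)² for every s ∈ [a,b]. Then there exists N such that for every integer n ≥ N, ∫_a^b ( (λ₁ − 2 α(s) H(s)²) n² cos²(n s) + 2 α(s) sin²(n s) ) ds < 0. In particular, the second-variation quadratic form is negative in the direction of the perturbation v(s) = sin(n s) for all sufficiently large n, so the straight line is linearly unstable on intervals where λ₁ < 2αH². -/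
open MeasureTheory Set Real

/-- The average of `cos²` over an interval tends to `1/2` at rate `1/c`, in a form without
division by the frequency `c`. -/
theorem half_sub_le_mul_integral_cos_sq (c a b : ℝ) :
    (c * (b - a) - 1) / 2 ≤ c * ∫ s in a..b, Real.cos (c * s) ^ 2 := by
  rw [intervalIntegral.mul_integral_comp_mul_left (f := fun x => Real.cos x ^ 2),
    integral_cos_sq]
  nlinarith [sq_nonneg (Real.cos (c * b) + Real.sin (c * b)),
    sq_nonneg (Real.cos (c * a) - Real.sin (c * a)),
    Real.sin_sq_add_cos_sq (c * a), Real.sin_sq_add_cos_sq (c * b)]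

/-- Linear instability: if `λ₁ < 2 α(s) H(s)²` on all of `[a,b]` (with `α, H` continuous and
nonnegative), then for all sufficiently large `n` the second variation in the direction
`v(s) = sin(ns)`, namely `∫ (λ₁ − 2αH²) n² cos²(ns) + 2α sin²(ns)`, is negative. -/
theorem second_variation_neg_of_unstable (lam₁ a b : ℝ) (hlam₁ : 0 < lam₁) (hab : a < b)
    (α H : ℝ → ℝ) (hαc : ContinuousOn α (Set.Icc a b)) (hHc : ContinuousOn H (Set.Icc a b))
    (hαnn : ∀ s ∈ Set.Icc a b, 0 ≤ α s) (hHnn : ∀ s ∈ Set.Icc a b, 0 ≤ H s)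
    (hunstab : ∀ s ∈ Set.Icc a b, lam₁ < 2 * α s * H s ^ 2) :
    ∃ N : ℕ, ∀ n : ℕ, N ≤ n →
      (∫ s in Set.Icc a b,
        ((lam₁ - 2 * α s * H s ^ 2) * (n : ℝ) ^ 2 * Real.cos (n * s) ^ 2
          + 2 * α s * Real.sin (n * s) ^ 2)) < 0 := by
  have hgc : ContinuousOn (fun s => 2 * α s * H s ^ 2 - lam₁) (Set.Icc a b) := by fun_prop
  have hne : (Set.Icc a b).Nonempty := ⟨a, Set.left_mem_Icc.2 hab.le⟩
  obtain ⟨s₀, hs₀, hmin⟩ := isCompact_Icc.exists_isMinOn hne hgc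
  obtain ⟨s₁, -, hmax⟩ := isCompact_Icc.exists_isMaxOn hne hαc
  obtain ⟨m, hm⟩ : ∃ m, m = 2 * α s₀ * H s₀ ^ 2 - lam₁ := ⟨_, rfl⟩
  have hm0 : 0 < m := by linarith [hunstab s₀ hs₀]
  have hL : 0 < b - a := sub_pos.2 hab
  obtain ⟨N, hN⟩ := exists_nat_gt (max (2 / (b - a)) (4 * α s₁ * (b - a) / m))
  refine ⟨N, fun n hn => ?_⟩
  have hnN : (N : ℝ) ≤ n := by exact_mod_cast hn
  have hn₁ : 2 < n * (b - a) :=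
    (div_lt_iff₀ hL).1 (((le_max_left _ _).trans_lt hN).trans_le hnN)
  have hn₂ : 4 * α s₁ * (b - a) < n * m :=
    (div_lt_iff₀ hm0).1 (((le_max_right _ _).trans_lt hN).trans_le hnN)
  rw [integral_Icc_eq_integral_Ioc, ← intervalIntegral.integral_of_le hab.le]
  have hle : (∫ s in a..b, ((lam₁ - 2 * α s * H s ^ 2) * (n : ℝ) ^ 2 * Real.cos (n * s) ^ 2
      + 2 * α s * Real.sin (n * s) ^ 2)) ≤
      ∫ s in a..b, (2 * α s₁ - m * (n : ℝ) ^ 2 * Real.cos (n * s) ^ 2) := by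
    refine intervalIntegral.integral_mono_on hab.le ?_ ?_ fun s hs => ?_
    · refine ContinuousOn.intervalIntegrable_of_Icc hab.le ?_
      fun_prop
    · exact Continuous.intervalIntegrable (by fun_prop) _ _
    · have h₁ : m ≤ 2 * α s * H s ^ 2 - lam₁ := hm ▸ hmin hs
      have h₂ : α s ≤ α s₁ := hmax hs
      have h₃ : α s * Real.sin (n * s) ^ 2 ≤ α s :=
        mul_le_of_le_one_right (hαnn s hs) (Real.sin_sq_le_one _)
      have h₄ : m * ((n : ℝ) ^ 2 * Real.cos (n * s) ^ 2) ≤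
          (2 * α s * H s ^ 2 - lam₁) * ((n : ℝ) ^ 2 * Real.cos (n * s) ^ 2) :=
        mul_le_mul_of_nonneg_right h₁ (by positivity)
      linarith
  refine hle.trans_lt ?_
  rw [intervalIntegral.integral_sub (by simp)
      (Continuous.intervalIntegrable (by fun_prop) _ _),
    intervalIntegral.integral_const, intervalIntegral.integral_const_mul, smul_eq_mul]
  have hI : 1 / 2 < n * ∫ s in a..b, Real.cos (n * s) ^ 2 := by
    linarith [half_sub_le_mul_integral_cos_sq n a b]
  have hnm : 0 < (n : ℝ) * m :=
    mul_pos (pos_of_mul_pos_left (by linarith) hL.le) hm0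
  nlinarith [mul_lt_mul_of_pos_left hI hnm]
end
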